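/- Consider an SMC particle system with M ≥ 1 particles on a measurable state space 𝒳, time horizon N ≥ 1, proposal kernels q_n, unnormalized targets γ_n with normalizing constants Z_n, incremental weights α_n(x_{1:n}) = γ_n(x_{1:n})/(γ_{n−1}(x_{1:n−1}) q_n(x_n|x_{1:n−1})) assumed strictly positive, and multinomial resampling at fixed times 0 = τ_0 < τ_1 < ⋯ < τ_r < τ_{r+1} = N, on a probability space carrying the filtration 𝓕_1 ⊆ 𝓕_2 ⊆ ⋯ ⊆ 𝓕_{2r+1} where 𝓕_{2t−1} is generated by the particle paths just before the t-th resampling and 𝓕_{2t} just after it. Assume: (i) at each resampling time τ_s, conditionally on 𝓕_{2s−1}, the resampled paths (X̄_{1:τ_s}^{(1)}, …, X̄_{1:τ_s}^{(M)}) are i.i.d., each equal to X_{1:τ_s}^{(j)} with probability V_{τ_s}^{(j)} = v_{τ_s}(X_{1:τ_s}^{(j)})/(M v̄_{τ_s}) where v_{τ_s}(x_{1:τ_s}) = ∏_{n=τ_{s−1}+1}^{τ_s} α_n(x_{1:n}) and v̄_{τ_s} = (1/M)∑_j v_{τ_s}(X_{1:τ_s}^{(j)}); (ii) between resampling times the M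 particles are propagated conditionally independently according to the proposal kernels q_n from their resampled ancestors; (iii) ψ : 𝒳^N → ℝ is such that ψ(X_{1:N}) L_N(X_{1:N}) is integrable, where L_N(x_{1:N}) = π_N(x_{1:N})/∏_{n=1}^{N} q_n(x_n|x_{1:n−1}) and π_N = γ_N/Z_N. Define f̃_n(x_{1:n}) = E_q[ψ(X_{1:N}) L_N(X_{1:N}) | X_{1:n} = x_{1:n}], ψ_N = E_{π_N}[ψ(X_{1:N})], the weights H̃_{τ_s}^{(i)} = (∏_{t=1}^{s} v̄_{τ_t})/∏_{n=1}^{τ_s} α_n(X_{1:n}^{(i)}) and H_{τ_s}^{(i)} = (∏_{t=1}^{s} v̄_{τ_t})/∏_{n=1}^{τ_s} α_n(X̄_{1:n}^{(i)}), the increments Z_{2s−1}^{(i)} = (f̃_{τ_s}(X_{1:τ_s}^{(i)}) − f̃_{τ_{s−1}}(X̄_{1:τ_{s−1}}^{(i)})) H_{τ_{s−1}}^{(i)} and Z_{2s}^{(i)} = f̃_{τ_s}(X̄_{1:τ_s}^{(i)}) H_{τ_s}^{(i)} − ∑_{j=1}^{M} V_{τ_s}^{(j)} f̃_{τ_s}(X_{1:τ_s}^{(j)})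 H̃_{τ_s}^{(j)}, and ψ̃_OR = (1/M) ∑_{i=1}^{M} L_N(X_{1:N}^{(i)}) ψ(X_{1:N}^{(i)}) H_{τ_r}^{(i)}. Then {(Z_k^{(1)}, …, Z_k^{(M)}), 𝓕_k : 1 ≤ k ≤ 2r+1} is a martingale difference sequence, i.e. E[Z_k^{(i)} | 𝓕_{k−1}] = 0 for all k ≥ 2 and E[Z_1^{(i)}] = 0, and M(ψ̃_OR − ψ_N) = ∑_{k=1}^{2r+1} (Z_k^{(1)} + ⋯ + Z_k^{(M)}). -/

import Mathlib

open MeasureTheory ProbabilityTheory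

/-- The integral with respect to the composition of a measure and a kernel is an iterated
integral. -/
lemma integral_bind_kernel {S T : Type*} [MeasurableSpace S] [MeasurableSpace T]
    {μ : Measure S} {κ : Kernel S T} {f : T → ℝ} (hf : Integrable f (μ.bind κ)) :
    ∫ y, f y ∂(μ.bind κ) = ∫ x, ∫ y, f y ∂κ x ∂μ := by
  rw [Measure.comp_eq_comp_const_apply] at hf ⊢
  rw [Kernel.integral_comp hf, Kernel.const_apply]

/-- Integrating out a kernel preserves integrability. -/
lemma integrable_integral_kernel_of_bind {S T : Type*} [MeasurableSpace S] [MeasurableSpace T]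
    {μ : Measure S} {κ : Kernel S T} {f : T → ℝ} (hf : Measurable f)
    (hint : Integrable f (μ.bind κ)) : Integrable (fun x => ∫ y, f y ∂κ x) μ :=
  ((Measure.integrable_comp_iff hf.aestronglyMeasurable).1 hint).2.mono'
    (hf.stronglyMeasurable.integral_kernel (κ := κ)).aestronglyMeasurable
    (ae_of_all _ fun _ => norm_integral_le_integral_norm _)

section ConditionalExpectation

variable {Ω : Type*} {m mΩ : MeasurableSpace Ω} {P : Measure Ω}

/-- A conditional expectation vanishes if it does so on each sublevel set of a
real-valued function measurable for the conditioning σ-algebra. -/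
lemma condExp_eq_zero_of_forall_indicator {Z W : Ω → ℝ} (hW : Measurable[m] W)
    (h : ∀ n : ℕ, P[{ω | W ω ≤ n}.indicator Z | m] =ᵐ[P] 0) :
    P[Z | m] =ᵐ[P] 0 := by
  by_cases hZ : Integrable Z P
  swap
  · rw [condExp_of_not_integrable hZ]
  have hS (n : ℕ) : MeasurableSet[m] {ω | W ω ≤ n} := hW measurableSet_Iic
  have hind : ∀ᵐ ω ∂P, ∀ n : ℕ, {ω | W ω ≤ n}.indicator (P[Z | m]) ω = 0 := by
    rw [ae_all_iff]
    intro n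
    filter_upwards [h n, condExp_indicator hZ (hS n)] with ω h₁ h₂
    rw [← h₂, h₁, Pi.zero_apply]
  filter_upwards [hind] with ω hω
  obtain ⟨n, hn⟩ := exists_nat_ge (W ω)
  simpa [Set.indicator_of_mem (show ω ∈ {ω | W ω ≤ n} from hn)] using hω n

/-- Multiplying by a factor measurable for the conditioning σ-algebra preserves the vanishing
of a conditional expectation. -/
lemma condExp_mul_eq_zero {h D : Ω → ℝ} (hh : StronglyMeasurable[m] h) (hD : Integrable D P)
    (hD0 : P[D | m] =ᵐ[P] 0) : P[h * D | m] =ᵐ[P] 0 := by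
  by_cases hhD : Integrable (h * D) P
  · filter_upwards [condExp_mul_of_stronglyMeasurable_left hh hhD hD, hD0] with ω h₁ h₂
    simp [h₁, h₂]
  · rw [condExp_of_not_integrable hhD]

/-- If `κ (Y ω)` is the conditional law of `X` given `m`, then restricting to an event in `m`
commutes with this disintegration. -/
lemma map_restrict_eq_bind {S T : Type*} [MeasurableSpace S] [MeasurableSpace T]
    [IsFiniteMeasure P] (hm : m ≤ mΩ) {X : Ω → T} {Y : Ω → S}
    (hX : Measurable X) (hY : Measurable[m] Y) (κ : Kernel S T) [IsMarkovKernel κ]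
    (h : ∀ A, MeasurableSet A →
      P[fun ω => A.indicator (fun _ => (1 : ℝ)) (X ω) | m] =ᵐ[P] fun ω => (κ (Y ω)).real A)
    {E : Set Ω} (hE : MeasurableSet[m] E) :
    (P.restrict E).map X = ((P.restrict E).map Y).bind κ := by
  have hY' : Measurable Y := hY.mono hm le_rfl
  ext A hA
  rw [Measure.bind_apply hA κ.aemeasurable, lintegral_map (κ.measurable_coe hA) hY',
    Measure.map_apply hX hA]
  have hint : Integrable (fun ω => A.indicator (fun _ => (1 : ℝ)) (X ω)) P :=
    (integrable_const (1 : ℝ)).indicator (hX hA)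
  have h₁ : ∫ ω in E, A.indicator (fun _ => (1 : ℝ)) (X ω) ∂P
      = ∫ ω in E, (κ (Y ω)).real A ∂P := by
    rw [← setIntegral_condExp hm hint hE]
    exact integral_congr_ae (ae_restrict_of_ae (h A hA))
  have h₂ : ∫ ω in E, A.indicator (fun _ => (1 : ℝ)) (X ω) ∂P
      = ((P.restrict E) (X ⁻¹' A)).toReal := by
    have : (fun ω => A.indicator (fun _ => (1 : ℝ)) (X ω))
        = (X ⁻¹' A).indicator (fun _ => (1 : ℝ)) := rfl
    rw [this, integral_indicator (hX hA), setIntegral_const, smul_eq_mul, mul_one,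
      measureReal_def]
  have h₃ : ∫ ω in E, (κ (Y ω)).real A ∂P = (∫⁻ ω in E, κ (Y ω) A ∂P).toReal :=
    integral_toReal ((κ.measurable_coe hA).comp hY').aemeasurable
      (ae_of_all _ fun ω => measure_lt_top _ _)
  have hfin : ∫⁻ ω in E, κ (Y ω) A ∂P ≠ ⊤ := by
    refine ne_top_of_le_ne_top (measure_ne_top P E) ?_
    calc ∫⁻ ω in E, κ (Y ω) A ∂P ≤ ∫⁻ _ in E, 1 ∂P := lintegral_mono fun _ => prob_le_one
      _ = P E := by simp
  exact (ENNReal.toReal_eq_toReal_iff' (measure_ne_top _ _) hfin).1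
    (h₂.symm.trans (h₁.trans h₃))

/-- If `κ (Y ω)` is the conditional law of `X` given `m`, then `G (X ω)` centred at
`∫ G ∂(κ (Y ω))` and multiplied by an `m`-measurable factor has zero conditional expectation. -/
lemma condExp_sub_integral_kernel_mul_eq_zero {S T : Type*} [MeasurableSpace S]
    [MeasurableSpace T] [IsFiniteMeasure P] (hm : m ≤ mΩ) {X : Ω → T} {Y : Ω → S}
    (hX : Measurable X) (hY : Measurable[m] Y) (κ : Kernel S T) [IsMarkovKernel κ]
    (h : ∀ A, MeasurableSet A →
      P[fun ω => A.indicator (fun _ => (1 : ℝ)) (X ω) | m] =ᵐ[P] fun ω => (κ (Y ω)).real A)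
    {G : T → ℝ} (hG : Measurable G) (hGint : ∀ᵐ ω ∂P, Integrable G (κ (Y ω)))
    {w : Ω → ℝ} (hw : Measurable[m] w) :
    P[fun ω => (G (X ω) - ∫ y, G y ∂κ (Y ω)) * w ω | m] =ᵐ[P] 0 := by
  have hY' : Measurable Y := hY.mono hm le_rfl
  have hW : Measurable[m] fun ω => ∫ y, ‖G y‖ ∂κ (Y ω) :=
    (hG.norm.stronglyMeasurable.integral_kernel (κ := κ)).measurable.comp hY
  have hB : Measurable[m] fun ω => ∫ y, G y ∂κ (Y ω) :=
    (hG.stronglyMeasurable.integral_kernel (κ := κ)).measurable.comp hY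
  refine condExp_eq_zero_of_forall_indicator hW fun n => ?_
  set s : Set Ω := {ω | ∫ y, ‖G y‖ ∂κ (Y ω) ≤ n}
  have hs : MeasurableSet[m] s := hW measurableSet_Iic
  have hWint : IntegrableOn (fun ω => ∫ y, ‖G y‖ ∂κ (Y ω)) s P := by
    refine Integrable.mono' (integrable_const (n : ℝ)) (hW.mono hm le_rfl).aestronglyMeasurable ?_
    filter_upwards [ae_restrict_mem (hm _ hs)] with ω hω
    rw [Real.norm_of_nonneg (integral_nonneg fun _ => norm_nonneg _)]
    exact hω
  have hbind {E : Set Ω} (hE : MeasurableSet[m] E) (hEs : E ⊆ s) :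
      Integrable G (((P.restrict E).map Y).bind κ) := by
    rw [Measure.integrable_comp_iff hG.aestronglyMeasurable]
    refine ⟨?_, ?_⟩
    · rw [ae_map_iff hY'.aemeasurable (measurableSet_integrable hG.stronglyMeasurable)]
      exact ae_restrict_of_ae hGint
    · rw [integrable_map_measure
        (hG.norm.stronglyMeasurable.integral_kernel (κ := κ)).aestronglyMeasurable
        hY'.aemeasurable]
      exact hWint.mono_set hEs
  have hXint : IntegrableOn (fun ω => G (X ω)) s P := by
    have := hbind hs subset_rfl
    rw [← map_restrict_eq_bind hm hX hY κ h hs] at this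
    exact this.comp_measurable hX
  have hBint : IntegrableOn (fun ω => ∫ y, G y ∂κ (Y ω)) s P :=
    hWint.mono' (hB.mono hm le_rfl).aestronglyMeasurable
      (ae_of_all _ fun ω => norm_integral_le_integral_norm _)
  have hD : Integrable (s.indicator fun ω => G (X ω) - ∫ y, G y ∂κ (Y ω)) P :=
    (integrable_indicator_iff (hm _ hs)).2 (hXint.sub hBint)
  have hD0 : P[s.indicator fun ω => G (X ω) - ∫ y, G y ∂κ (Y ω) | m] =ᵐ[P] 0 := by
    refine (ae_eq_condExp_of_forall_setIntegral_eq hm hD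
      (fun _ _ _ => integrableOn_zero) (fun E hE _ => ?_) aestronglyMeasurable_zero).symm
    have hEs : MeasurableSet[m] (E ∩ s) := hE.inter hs
    have hEX : ∫ ω in E ∩ s, G (X ω) ∂P = ∫ ω in E ∩ s, ∫ y, G y ∂κ (Y ω) ∂P := by
      rw [← integral_map hX.aemeasurable hG.aestronglyMeasurable,
        map_restrict_eq_bind hm hX hY κ h hEs,
        integral_bind_kernel (hbind hEs Set.inter_subset_right),
        integral_map hY'.aemeasurable
          (hG.stronglyMeasurable.integral_kernel (κ := κ)).aestronglyMeasurable]
    rw [setIntegral_indicator (hm _ hs), integral_sub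
      (hXint.mono_set Set.inter_subset_right) (hBint.mono_set Set.inter_subset_right), hEX]
    simp
  have hprod : s.indicator (fun ω => (G (X ω) - ∫ y, G y ∂κ (Y ω)) * w ω)
      = w * s.indicator (fun ω => G (X ω) - ∫ y, G y ∂κ (Y ω)) := by
    ext ω
    by_cases hω : ω ∈ s <;> simp [hω, mul_comm]
  rw [hprod]
  exact condExp_mul_eq_zero hw.stronglyMeasurable hD hD0

/-- Selecting one of finitely many `m`-measurable values at random, with conditional selection
probabilities `V j`, has conditional mean `∑ j, V j * c j`. -/
lemma condExp_select_sub_sum_eq_zero {ι : Type*} [Fintype ι] [DecidableEq ι]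
    [IsFiniteMeasure P] (hm : m ≤ mΩ) {J : Ω → ι} {V c : ι → Ω → ℝ}
    (hJ : ∀ j, Integrable ({ω | J ω = j}.indicator fun _ => (1 : ℝ)) P)
    (hV : ∀ j, P[{ω | J ω = j}.indicator (fun _ => (1 : ℝ)) | m] =ᵐ[P] V j)
    (hc : ∀ j, Measurable[m] (c j)) :
    P[fun ω => c (J ω) ω - ∑ j, V j ω * c j ω | m] =ᵐ[P] 0 := by
  set w : Ω → ℝ := fun ω => 1 + ∑ j, |c j ω| with hw_def
  have hw : Measurable[m] w :=
    measurable_const.add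
      (Finset.measurable_fun_sum _ fun j _ => continuous_abs.measurable.comp (hc j))
  have hw_pos (ω : Ω) : 0 < w ω :=
    add_pos_of_pos_of_nonneg one_pos (Finset.sum_nonneg fun _ _ => abs_nonneg _)
  have hcw (j : ι) (ω : Ω) : ‖c j ω / w ω‖ ≤ 1 := by
    rw [norm_div, Real.norm_of_nonneg (hw_pos ω).le, div_le_one (hw_pos ω), Real.norm_eq_abs]
    have := Finset.single_le_sum (f := fun k => |c k ω|) (fun _ _ => abs_nonneg _)
      (Finset.mem_univ j)
    simp only [hw_def]
    linarith
  have hcw_meas (j : ι) : StronglyMeasurable[m] fun ω => c j ω / w ω :=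
    ((hc j).div hw).stronglyMeasurable
  set d : ι → Ω → ℝ := fun j => {ω | J ω = j}.indicator (fun _ => (1 : ℝ)) - V j with hd_def
  have hVint (j : ι) : Integrable (V j) P := integrable_condExp.congr (hV j)
  have hd (j : ι) : Integrable (d j) P := (hJ j).sub (hVint j)
  have hd0 (j : ι) : P[d j | m] =ᵐ[P] 0 := by
    have h₁ : P[V j | m] =ᵐ[P] V j :=
      (condExp_congr_ae (hV j).symm).trans
        ((condExp_condExp_of_le le_rfl hm).trans (hV j))
    filter_upwards [condExp_sub (hJ j) (hVint j) m, h₁, hV j] with ω h₂ h₃ h₄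
    rw [h₂, Pi.sub_apply, h₃, h₄, sub_self, Pi.zero_apply]
  have hterm (j : ι) : Integrable ((fun ω => c j ω / w ω) * d j) P :=
    (hd j).bdd_mul ((hcw_meas j).mono hm).aestronglyMeasurable (ae_of_all _ (hcw j))
  have hterm0 (j : ι) : P[(fun ω => c j ω / w ω) * d j | m] =ᵐ[P] 0 :=
    condExp_mul_eq_zero (hcw_meas j) (hd j) (hd0 j)
  have hsum0 : P[∑ j, (fun ω => c j ω / w ω) * d j | m] =ᵐ[P] 0 := by
    have hall : ∀ᵐ ω ∂P, ∀ j, P[(fun ω => c j ω / w ω) * d j | m] ω = 0 :=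
      ae_all_iff.2 hterm0
    filter_upwards [condExp_finsetSum (s := Finset.univ) (fun j _ => hterm j) m, hall]
      with ω h₁ h₂
    rw [h₁, Finset.sum_apply, Finset.sum_eq_zero fun j _ => h₂ j, Pi.zero_apply]
  have hfactor : (fun ω => c (J ω) ω - ∑ j, V j ω * c j ω)
      = w * ∑ j, (fun ω => c j ω / w ω) * d j := by
    ext ω
    have hsel : ∑ j, c j ω * {ω | J ω = j}.indicator (fun _ => (1 : ℝ)) ω = c (J ω) ω := by
      rw [Finset.sum_eq_single (J ω)]
      · simp
      · intro j _ hj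
        simp [hj.symm]
      · simp
    rw [Pi.mul_apply, Finset.sum_apply, Finset.mul_sum, ← hsel, ← Finset.sum_sub_distrib]
    refine Finset.sum_congr rfl fun j _ => ?_
    simp only [hd_def, Pi.mul_apply, Pi.sub_apply]
    field_simp [(hw_pos ω).ne']
  rw [hfactor]
  exact condExp_mul_eq_zero hw.stronglyMeasurable
    (integrable_finsetSum' _ fun j _ => hterm j) hsum0

/-- If finitely many indices `J k` are conditionally i.i.d. given `m` with strictly positive
probabilities `V j`, then each of them has conditional law `V`. -/
lemma condExp_indicator_of_iid {ι κ : Type*} [Fintype ι] [DecidableEq ι] [Fintype κ]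
    [DecidableEq κ] [IsFiniteMeasure P] [NeZero P] {J : κ → Ω → ι} {V : ι → Ω → ℝ}
    (hVpos : ∀ j ω, 0 < V j ω) (hVsum : ∀ ω, ∑ j, V j ω = 1)
    (h : ∀ js : κ → ι, P[fun ω => ({ω' | ∀ k, J k ω' = js k} : Set Ω).indicator
        (fun _ => (1 : ℝ)) ω | m] =ᵐ[P] fun ω => ∏ k, V (js k) ω) (k : κ) (j : ι) :
    Integrable ({ω | J k ω = j}.indicator fun _ => (1 : ℝ)) P ∧
      P[{ω | J k ω = j}.indicator (fun _ => (1 : ℝ)) | m] =ᵐ[P] V j := by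
  have hint (js : κ → ι) : Integrable
      (fun ω => ({ω' | ∀ k, J k ω' = js k} : Set Ω).indicator (fun _ => (1 : ℝ)) ω) P := by
    by_contra hcon
    have h₀ := h js
    rw [condExp_of_not_integrable hcon] at h₀
    obtain ⟨ω, hω⟩ := h₀.exists
    exact (Finset.prod_pos fun k _ => hVpos (js k) ω).ne hω
  set t : κ → Finset ι := fun l => if l = k then {j} else Finset.univ with ht
  have hdecomp : {ω | J k ω = j}.indicator (fun _ => (1 : ℝ))
      = ∑ js ∈ Fintype.piFinset t, fun ω =>
        ({ω' | ∀ k, J k ω' = js k} : Set Ω).indicator (fun _ => (1 : ℝ)) ω := by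
    ext ω
    rw [Finset.sum_apply]
    by_cases hω : J k ω = j
    · rw [Finset.sum_eq_single fun l => J l ω]
      · simp [hω]
      · intro js _ hjs
        refine Set.indicator_of_notMem (fun hmem => hjs ?_) _
        ext l
        exact (hmem l).symm
      · intro hmem
        refine absurd (Fintype.mem_piFinset.2 fun l => ?_) hmem
        by_cases hl : l = k
        · subst hl
          simp [ht, hω]
        · simp [ht, hl]
    · rw [Finset.sum_eq_zero]
      · simp [hω]
      · intro js hjs
        have hk := Fintype.mem_piFinset.1 hjs k
        simp only [ht, if_true, Finset.mem_singleton] at hk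
        exact Set.indicator_of_notMem (fun hmem => hω ((hmem k).trans hk)) _
  have hprod (ω : Ω) : ∑ js ∈ Fintype.piFinset t, ∏ l, V (js l) ω = V j ω := by
    rw [← Finset.prod_univ_sum t fun _ i => V i ω, Finset.prod_eq_single k]
    · simp [ht]
    · intro l _ hl
      simp [ht, hl, hVsum]
    · simp
  rw [hdecomp]
  refine ⟨integrable_finsetSum' _ fun js _ => hint js, ?_⟩
  filter_upwards [condExp_finsetSum (s := Fintype.piFinset t) (fun js _ => hint js) m,
    ae_all_iff.2 h] with ω h₁ h₂
  rw [h₁, Finset.sum_apply, ← hprod ω]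
  exact Finset.sum_congr rfl fun js _ => h₂ js

end ConditionalExpectation

/-- A measurable function that is constant on a set of full outer measure integrates to its
value there. -/
lemma integral_eq_of_forall_mem_of_measure_eq_one {S : Type*} [MeasurableSpace S]
    {μ : Measure S} [IsProbabilityMeasure μ] {f : S → ℝ} (hf : Measurable f) {A : Set S}
    (hA : μ A = 1) {c : ℝ} (hc : ∀ y ∈ A, f y = c) : ∫ y, f y ∂μ = c := by
  have hmeas : MeasurableSet {y | f y = c} := hf (measurableSet_singleton c)
  have hae : ∀ᵐ y ∂μ, f y = c := by
    rw [ae_iff, ← Set.compl_ofPred, prob_compl_eq_zero_iff hmeas]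
    exact le_antisymm prob_le_one (hA ▸ measure_mono hc)
  rw [integral_congr_ae hae]
  simp

/-- The Proposition in the appendix: for an SMC particle system with `M` particles,
strictly positive incremental weights `α`, multinomial resampling at fixed times
`τ 1 < ⋯ < τ r` and conditionally independent propagation according to the proposal
kernels between resampling times, the increments `Zodd`/`Zeven` form a martingale
difference sequence with respect to the filtration `𝓕`, and
`M (ψ̃_OR − ψ_N) = ∑_{k=1}^{2r+1} (Z_k^{(1)} + ⋯ + Z_k^{(M)})`. -/
theorem smc_martingale_difference_proposition
    {𝒳 : Type*} [MeasurableSpace 𝒳]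
    {Ω : Type*} {mΩ : MeasurableSpace Ω} (P : Measure Ω) [IsProbabilityMeasure P]
    (N M r : ℕ) (hM : 1 ≤ M) (hN : 1 ≤ N)
    (τ : ℕ → ℕ) (hτ0 : τ 0 = 0) (hτmono : ∀ s, s ≤ r → τ s < τ (s + 1))
    (hτN : τ (r + 1) = N)
    -- the proposal law `Q` on path space and its conditional kernels `κ n` given the
    -- first `n` coordinates (composition of the proposal kernels `q_{n+1}, q_{n+2}, …`)
    (Q : Measure (ℕ → 𝒳)) [IsProbabilityMeasure Q]
    (κ : ℕ → Kernel (ℕ → 𝒳) (ℕ → 𝒳)) [∀ n, IsMarkovKernel (κ n)]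
    (hκsupp : ∀ n x, (κ n x) {y | ∀ k, 1 ≤ k → k ≤ n → y k = x k} = 1)
    (hκloc : ∀ n x y, (∀ k, 1 ≤ k → k ≤ n → x k = y k) → κ n x = κ n y)
    (hκQ : ∀ n, n ≤ N → Q.bind (κ n) = Q)
    (hκcomp : ∀ m n, m ≤ n → n ≤ N → ∀ x, (κ m x).bind (κ n) = κ m x)
    -- strictly positive incremental weights
    (α : ℕ → (ℕ → 𝒳) → ℝ) (hαmeas : ∀ n, Measurable (α n))
    (hαpos : ∀ n x, 0 < α n x)
    (hαloc : ∀ n x y, (∀ k, 1 ≤ k → k ≤ n → x k = y k) → α n x = α n y)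
    -- normalizing constant and likelihood ratio `L_N = π_N / ∏ q_n = (∏ α_n) / Z_N`
    (ZN : ℝ) (hZNpos : 0 < ZN)
    (hZN : ∫ x, ∏ n ∈ Finset.Icc 1 N, α n x ∂Q = ZN)
    (L : (ℕ → 𝒳) → ℝ) (hL : ∀ x, L x = (∏ n ∈ Finset.Icc 1 N, α n x) / ZN)
    -- test function `ψ` with `ψ(X_{1:N}) L_N(X_{1:N})` integrable
    (ψ : (ℕ → 𝒳) → ℝ) (hψmeas : Measurable ψ)
    (hψloc : ∀ x y, (∀ k, 1 ≤ k → k ≤ N → x k = y k) → ψ x = ψ y)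
    (hψLint : Integrable (fun x => ψ x * L x) Q)
    (ψN : ℝ) (hψN : ψN = ∫ x, ψ x * L x ∂Q)
    -- `f̃_n(x_{1:n}) = E_q[ψ(X_{1:N}) L_N(X_{1:N}) | X_{1:n} = x_{1:n}]`
    (ftil : ℕ → (ℕ → 𝒳) → ℝ)
    (hftil : ∀ n x, ftil n x = ∫ y, ψ y * L y ∂(κ n x))
    -- the particle system: `X s i` is particle `i`'s path just before the `s`-th
    -- resampling, `Xbar s i` the path just after it; `𝓕` is the filtration
    (𝓕 : ℕ → MeasurableSpace Ω)
    (h𝓕le : ∀ k, 𝓕 k ≤ mΩ) (h𝓕mono : Monotone 𝓕)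
    (X Xbar : ℕ → Fin M → Ω → (ℕ → 𝒳))
    (hXmeas : ∀ s, 1 ≤ s → s ≤ r + 1 → ∀ i, Measurable[𝓕 (2 * s - 1)] (X s i))
    (hXbarmeas : ∀ s, 1 ≤ s → s ≤ r → ∀ i, Measurable[𝓕 (2 * s)] (Xbar s i))
    -- accumulated incremental weights and resampling probabilities
    (v : ℕ → Fin M → Ω → ℝ)
    (hv : ∀ s, 1 ≤ s → s ≤ r + 1 → ∀ i ω,
      v s i ω = ∏ n ∈ Finset.Icc (τ (s - 1) + 1) (τ s), α n (X s i ω))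
    (vbar : ℕ → Ω → ℝ)
    (hvbar : ∀ s, 1 ≤ s → s ≤ r + 1 → ∀ ω, vbar s ω = (∑ j, v s j ω) / M)
    (V : ℕ → Fin M → Ω → ℝ)
    (hV : ∀ s, 1 ≤ s → s ≤ r + 1 → ∀ i ω, V s i ω = v s i ω / (M * vbar s ω))
    -- (i) multinomial resampling: conditionally on `𝓕 (2s−1)` the resampled paths are
    -- i.i.d., each equal to `X s j` with probability `V s j`
    (I : ℕ → Fin M → Ω → Fin M)
    (hXbarI : ∀ s, 1 ≤ s → s ≤ r → ∀ i ω, Xbar s i ω = X s (I s i ω) ω)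
    (hresample : ∀ s, 1 ≤ s → s ≤ r → ∀ js : Fin M → Fin M,
      P[(fun ω => ({ω' | ∀ i, I s i ω' = js i} : Set Ω).indicator
          (fun _ => (1 : ℝ)) ω) | 𝓕 (2 * s - 1)]
        =ᵐ[P] fun ω => ∏ i, V s (js i) ω)
    -- (ii) conditionally independent propagation according to the proposal kernels,
    -- extending the resampled ancestors
    (hXext : ∀ s, 1 ≤ s → s ≤ r → ∀ i ω k, 1 ≤ k → k ≤ τ s →
      X (s + 1) i ω k = Xbar s i ω k)
    (hinit : ∀ f : Fin M → (ℕ → 𝒳) → ℝ,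
      (∀ i, Measurable (f i)) → (∀ i, ∃ C, ∀ x, |f i x| ≤ C) →
      ∫ ω, ∏ i, f i (X 1 i ω) ∂P = ∏ i : Fin M, ∫ y, f i y ∂Q)
    (hprop : ∀ s, 1 ≤ s → s ≤ r → ∀ f : Fin M → (ℕ → 𝒳) → ℝ,
      (∀ i, Measurable (f i)) → (∀ i, ∃ C, ∀ x, |f i x| ≤ C) →
      P[(fun ω => ∏ i, f i (X (s + 1) i ω)) | 𝓕 (2 * s)]
        =ᵐ[P] fun ω => ∏ i, ∫ y, f i y ∂(κ (τ s) (Xbar s i ω)))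
    -- the pre- and post-resampling weights `H̃` and `H`
    (Htil : ℕ → Fin M → Ω → ℝ)
    (hHtil : ∀ s, 1 ≤ s → s ≤ r + 1 → ∀ i ω,
      Htil s i ω = (∏ t ∈ Finset.Icc 1 s, vbar t ω)
        / ∏ n ∈ Finset.Icc 1 (τ s), α n (X s i ω))
    (H : ℕ → Fin M → Ω → ℝ)
    (hH0 : ∀ i ω, H 0 i ω = 1)
    (hH : ∀ s, 1 ≤ s → s ≤ r → ∀ i ω,
      H s i ω = (∏ t ∈ Finset.Icc 1 s, vbar t ω)
        / ∏ n ∈ Finset.Icc 1 (τ s), α n (Xbar s i ω))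
    -- the martingale increments
    (Zodd : ℕ → Fin M → Ω → ℝ)
    (hZodd : ∀ s, 1 ≤ s → s ≤ r + 1 → ∀ i ω,
      Zodd s i ω = (ftil (τ s) (X s i ω) - ftil (τ (s - 1)) (Xbar (s - 1) i ω))
        * H (s - 1) i ω)
    (Zeven : ℕ → Fin M → Ω → ℝ)
    (hZeven : ∀ s, 1 ≤ s → s ≤ r → ∀ i ω,
      Zeven s i ω = ftil (τ s) (Xbar s i ω) * H s i ω
        - ∑ j, V s j ω * ftil (τ s) (X s j ω) * Htil s j ω)
    -- the estimator `ψ̃_OR`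
    (ψtil : Ω → ℝ)
    (hψtil : ∀ ω, ψtil ω
      = (1 / M) * ∑ i, L (X (r + 1) i ω) * ψ (X (r + 1) i ω) * H r i ω) :
    -- martingale difference property: `E[Z_1^{(i)}] = 0` and `E[Z_k^{(i)} | 𝓕_{k−1}] = 0`
    (∀ i, ∫ ω, Zodd 1 i ω ∂P = 0) ∧
    (∀ s, 2 ≤ s → s ≤ r + 1 → ∀ i,
      P[Zodd s i | 𝓕 (2 * s - 2)] =ᵐ[P] (fun _ => 0)) ∧
    (∀ s, 1 ≤ s → s ≤ r → ∀ i,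
      P[Zeven s i | 𝓕 (2 * s - 1)] =ᵐ[P] (fun _ => 0)) ∧
    -- the decomposition `M (ψ̃_OR − ψ_N) = ∑_{k=1}^{2r+1} ∑_i Z_k^{(i)}`
    (∀ ω, (M : ℝ) * (ψtil ω - ψN)
      = (∑ s ∈ Finset.Icc 1 (r + 1), ∑ i, Zodd s i ω)
        + ∑ s ∈ Finset.Icc 1 r, ∑ i, Zeven s i ω) := by
  have hMpos : (0 : ℝ) < M := by exact_mod_cast hM
  have hMne : NeZero M := ⟨by omega⟩
  have hτle (s : ℕ) (hs : s ≤ r + 1) : τ s ≤ N := by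
    rw [← hτN]
    refine Nat.decreasingInduction' (P := fun k => τ k ≤ τ (r + 1))
      (fun k hk _ ih => (hτmono k (by omega)).le.trans ih) hs le_rfl
  have hLmeas : Measurable L := by
    rw [funext hL]
    exact (Finset.measurable_fun_prod _ fun n _ => hαmeas n).div_const _
  have hψL : Measurable fun x => ψ x * L x := hψmeas.mul hLmeas
  have hftil_meas (n : ℕ) : Measurable (ftil n) := by
    rw [funext (hftil n)]
    exact (hψL.stronglyMeasurable.integral_kernel (κ := κ n)).measurable
  -- values of `ftil` at the two ends
  have hftil_zero (x : ℕ → 𝒳) : ftil 0 x = ψN := by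
    have hconst : ⇑(κ 0) = fun _ => κ 0 x :=
      funext fun y => hκloc 0 y x fun k h₁ h₂ => by omega
    have hQ : κ 0 x = Q := by
      have h := hκQ 0 (Nat.zero_le N)
      rw [hconst, Measure.bind_const, measure_univ, one_smul] at h
      exact h
    rw [hftil, hQ, hψN]
  have hftil_N (x : ℕ → 𝒳) : ftil N x = ψ x * L x := by
    rw [hftil]
    refine integral_eq_of_forall_mem_of_measure_eq_one hψL (hκsupp N x) fun y hy => ?_
    rw [hψloc y x hy, hL, hL]
    congr 2
    refine Finset.prod_congr rfl fun n hn => hαloc n y x fun k h₁ h₂ => hy k h₁ ?_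
    exact h₂.trans (Finset.mem_Icc.1 hn).2
  -- the tower property of `ftil`
  have hftil_tower {m n : ℕ} (hmn : m ≤ n) (hn : n ≤ N) {x : ℕ → 𝒳}
      (hx : Integrable (fun y => ψ y * L y) (κ m x)) :
      Integrable (ftil n) (κ m x) ∧ ∫ y, ftil n y ∂κ m x = ftil m x := by
    have hx' : Integrable (fun y => ψ y * L y) ((κ m x).bind (κ n)) := by
      rwa [hκcomp m n hmn hn x]
    refine ⟨?_, ?_⟩
    · rw [funext (hftil n)]
      exact integrable_integral_kernel_of_bind hψL hx'
    · rw [hftil m x, funext (hftil n), ← integral_bind_kernel hx', hκcomp m n hmn hn x]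
  have hQint {n : ℕ} (hn : n ≤ N) : ∀ᵐ x ∂Q, Integrable (fun y => ψ y * L y) (κ n x) := by
    have h : Integrable (fun y => ψ y * L y) (Q.bind (κ n)) := by rwa [hκQ n hn]
    exact ((Measure.integrable_comp_iff hψL.aestronglyMeasurable).1 h).1
  -- positivity and measurability of the weights
  have hvpos (s : ℕ) (h₁ : 1 ≤ s) (h₂ : s ≤ r + 1) (i : Fin M) (ω : Ω) : 0 < v s i ω := by
    rw [hv s h₁ h₂]
    exact Finset.prod_pos fun n _ => hαpos n _
  have hvbarpos (s : ℕ) (h₁ : 1 ≤ s) (h₂ : s ≤ r + 1) (ω : Ω) : 0 < vbar s ω := by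
    rw [hvbar s h₁ h₂]
    exact div_pos (Finset.sum_pos (fun j _ => hvpos s h₁ h₂ j ω) Finset.univ_nonempty) hMpos
  have hVpos (s : ℕ) (h₁ : 1 ≤ s) (h₂ : s ≤ r + 1) (i : Fin M) (ω : Ω) : 0 < V s i ω := by
    rw [hV s h₁ h₂]
    exact div_pos (hvpos s h₁ h₂ i ω) (mul_pos hMpos (hvbarpos s h₁ h₂ ω))
  have hVsum (s : ℕ) (h₁ : 1 ≤ s) (h₂ : s ≤ r + 1) (ω : Ω) : ∑ j, V s j ω = 1 := by
    have hne := (mul_pos hMpos (hvbarpos s h₁ h₂ ω)).ne'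
    simp_rw [hV s h₁ h₂, ← Finset.sum_div]
    rw [div_eq_one_iff_eq hne, hvbar s h₁ h₂, mul_div_cancel₀ _ hMpos.ne']
  have hvbar_meas (t k : ℕ) (h₁ : 1 ≤ t) (h₂ : t ≤ r + 1) (hk : 2 * t - 1 ≤ k) :
      Measurable[𝓕 k] (vbar t) := by
    rw [funext (hvbar t h₁ h₂)]
    refine Measurable.div_const (Finset.measurable_fun_sum _ fun j _ => ?_) _
    rw [funext (hv t h₁ h₂ j)]
    exact Finset.measurable_fun_prod _ fun n _ =>
      (hαmeas n).comp ((hXmeas t h₁ h₂ j).mono (h𝓕mono hk) le_rfl)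
  have hHtil_meas (s : ℕ) (h₁ : 1 ≤ s) (h₂ : s ≤ r + 1) (i : Fin M) :
      Measurable[𝓕 (2 * s - 1)] (Htil s i) := by
    rw [funext (hHtil s h₁ h₂ i)]
    refine Measurable.div (Finset.measurable_fun_prod _ fun t ht => ?_)
      (Finset.measurable_fun_prod _ fun n _ => (hαmeas n).comp (hXmeas s h₁ h₂ i))
    obtain ⟨h₃, h₄⟩ := Finset.mem_Icc.1 ht
    exact hvbar_meas t _ h₃ (by omega) (by omega)
  have hH_meas (s : ℕ) (h₁ : 1 ≤ s) (h₂ : s ≤ r) (i : Fin M) :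
      Measurable[𝓕 (2 * s)] (H s i) := by
    rw [funext (hH s h₁ h₂ i)]
    refine Measurable.div (Finset.measurable_fun_prod _ fun t ht => ?_)
      (Finset.measurable_fun_prod _ fun n _ => (hαmeas n).comp (hXbarmeas s h₁ h₂ i))
    obtain ⟨h₃, h₄⟩ := Finset.mem_Icc.1 ht
    exact hvbar_meas t _ h₃ (by omega) (by omega)
  have hX_meas (s : ℕ) (h₁ : 1 ≤ s) (h₂ : s ≤ r + 1) (i : Fin M) : Measurable (X s i) :=
    (hXmeas s h₁ h₂ i).mono (h𝓕le _) le_rfl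
  have hXbar_meas (s : ℕ) (h₁ : 1 ≤ s) (h₂ : s ≤ r) (i : Fin M) : Measurable (Xbar s i) :=
    (hXbarmeas s h₁ h₂ i).mono (h𝓕le _) le_rfl
  -- laws of single particles
  have hbdd (i : Fin M) (A : Set (ℕ → 𝒳)) (k : Fin M) : ∃ C, ∀ x,
      |(if k = i then A.indicator (fun _ => (1 : ℝ)) else fun _ => 1) x| ≤ C := by
    refine ⟨1, fun x => ?_⟩
    split_ifs
    · by_cases hx : x ∈ A <;> simp [hx]
    · simp
  have hmeasind (i : Fin M) {A : Set (ℕ → 𝒳)} (hA : MeasurableSet A) (k : Fin M) :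
      Measurable (if k = i then A.indicator (fun _ => (1 : ℝ)) else fun _ => 1) := by
    split_ifs
    · exact measurable_const.indicator hA
    · exact measurable_const
  have hlaw_init (i : Fin M) : P.map (X 1 i) = Q := by
    ext A hA
    have h := hinit (fun k => if k = i then A.indicator (fun _ => (1 : ℝ)) else fun _ => 1)
      (hmeasind i hA) (hbdd i A)
    have hl (ω : Ω) : (∏ k, (if k = i then A.indicator (fun _ => (1 : ℝ)) else fun _ => 1)
        (X 1 k ω)) = (X 1 i ⁻¹' A).indicator (fun _ => (1 : ℝ)) ω := by
      rw [Finset.prod_eq_single i (fun k _ hk => by simp [hk]) (by simp), if_pos rfl]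
      rfl
    have hr : (∏ k : Fin M, ∫ y, (if k = i then A.indicator (fun _ => (1 : ℝ)) else fun _ => 1) y
        ∂Q) = Q.real A := by
      rw [Finset.prod_eq_single i (fun k _ hk => by simp [hk]) (by simp), if_pos rfl,
        integral_indicator hA]
      simp
    have hXA := hX_meas 1 le_rfl (by omega) i hA
    simp only [hl] at h
    rw [hr, integral_indicator hXA] at h
    simp only [setIntegral_const, smul_eq_mul, mul_one] at h
    rw [Measure.map_apply (hX_meas 1 le_rfl (by omega) i) hA]
    exact (measureReal_eq_measureReal_iff).1 h
  have hlaw_step (s : ℕ) (h₁ : 1 ≤ s) (h₂ : s ≤ r) (i : Fin M) (A : Set (ℕ → 𝒳))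
      (hA : MeasurableSet A) :
      P[fun ω => A.indicator (fun _ => (1 : ℝ)) (X (s + 1) i ω) | 𝓕 (2 * s)]
        =ᵐ[P] fun ω => (κ (τ s) (Xbar s i ω)).real A := by
    have h := hprop s h₁ h₂
      (fun k => if k = i then A.indicator (fun _ => (1 : ℝ)) else fun _ => 1)
      (hmeasind i hA) (hbdd i A)
    have hl : (fun ω => ∏ k, (if k = i then A.indicator (fun _ => (1 : ℝ)) else fun _ => 1)
        (X (s + 1) k ω)) = fun ω => A.indicator (fun _ => (1 : ℝ)) (X (s + 1) i ω) := by
      ext ω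
      rw [Finset.prod_eq_single i (fun k _ hk => by simp [hk]) (by simp), if_pos rfl]
    have hr : (fun ω => ∏ k : Fin M, ∫ y,
        (if k = i then A.indicator (fun _ => (1 : ℝ)) else fun _ => 1) y
        ∂κ (τ s) (Xbar s k ω)) = fun ω => (κ (τ s) (Xbar s i ω)).real A := by
      ext ω
      rw [Finset.prod_eq_single i (fun k _ hk => by simp [hk]) (by simp), if_pos rfl,
        integral_indicator hA]
      simp
    rwa [hl, hr] at h
  have hXbar_ac (s : ℕ) (h₁ : 1 ≤ s) (h₂ : s ≤ r) (hX : ∀ i, P.map (X s i) ≪ Q) (i : Fin M) :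
      P.map (Xbar s i) ≪ Q := by
    refine Measure.AbsolutelyContinuous.mk fun A hA hQA => ?_
    rw [Measure.map_apply (hXbar_meas s h₁ h₂ i) hA]
    refine measure_mono_null (t := ⋃ j, X s j ⁻¹' A) (fun ω hω => ?_) ?_
    · refine Set.mem_iUnion.2 ⟨I s i ω, ?_⟩
      rwa [Set.mem_preimage, hXbarI s h₁ h₂] at hω
    · refine measure_iUnion_null fun j => ?_
      rw [← Measure.map_apply (hX_meas s h₁ (by omega) j) hA]
      exact hX j hQA
  have hX_ac (s : ℕ) (h₁ : 1 ≤ s) : s ≤ r + 1 → ∀ i, P.map (X s i) ≪ Q := by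
    induction s, h₁ using Nat.le_induction with
    | base => exact fun _ i => (hlaw_init i).absolutelyContinuous
    | succ s h₁ ih =>
      intro h₂ i
      have h := map_restrict_eq_bind (h𝓕le _) (hX_meas (s + 1) (by omega) h₂ i)
        (hXbarmeas s h₁ (by omega) i) (κ (τ s)) (hlaw_step s h₁ (by omega) i) .univ
      rw [Measure.restrict_univ] at h
      rw [h, ← hκQ (τ s) (hτle s (by omega))]
      exact (hXbar_ac s h₁ (by omega) (ih (by omega)) i).comp_right _
  -- relation between the pre- and post-resampling weights
  have hweights (s : ℕ) (h₂ : s ≤ r) (j : Fin M) (ω : Ω) :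
      M * (V (s + 1) j ω * Htil (s + 1) j ω) = H s j ω := by
    have h₁ : 1 ≤ s + 1 := by omega
    have h₃ : s + 1 ≤ r + 1 := by omega
    have hHs : H s j ω = (∏ t ∈ Finset.Icc 1 s, vbar t ω)
        / ∏ n ∈ Finset.Icc 1 (τ s), α n (X (s + 1) j ω) := by
      rcases Nat.eq_zero_or_pos s with rfl | hs
      · simp [hH0, hτ0]
      · rw [hH s hs h₂]
        congr 1
        refine Finset.prod_congr rfl fun n hn => hαloc n _ _ fun k hk₁ hk₂ => ?_
        exact (hXext s hs h₂ j ω k hk₁ (hk₂.trans (Finset.mem_Icc.1 hn).2)).symm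
    have hsplit : ∏ n ∈ Finset.Icc 1 (τ (s + 1)), α n (X (s + 1) j ω)
        = (∏ n ∈ Finset.Icc 1 (τ s), α n (X (s + 1) j ω)) * v (s + 1) j ω := by
      rw [hv (s + 1) h₁ h₃, Nat.add_sub_cancel]
      have hIcc (a b : ℕ) : Finset.Icc (a + 1) b = Finset.Ioc a b := by
        ext n
        simp only [Finset.mem_Icc, Finset.mem_Ioc]
        omega
      rw [← zero_add 1, hIcc, hIcc, zero_add, hIcc]
      exact (Finset.prod_Ioc_consecutive _ (Nat.zero_le _) (hτmono s h₂).le).symm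
    have hprod_pos : 0 < ∏ n ∈ Finset.Icc 1 (τ s), α n (X (s + 1) j ω) :=
      Finset.prod_pos fun n _ => hαpos n _
    have hv_pos := hvpos (s + 1) h₁ h₃ j ω
    have hvbar_pos := hvbarpos (s + 1) h₁ h₃ ω
    rw [hHs, hV (s + 1) h₁ h₃, hHtil (s + 1) h₁ h₃, hsplit, Finset.prod_Icc_succ_top h₁]
    field_simp
  refine ⟨fun i => ?_, fun s h₁ h₂ i => ?_, fun s h₁ h₂ i => ?_, fun ω => ?_⟩
  · have hint : Integrable (ftil (τ 1)) Q ∧ ∫ x, ftil (τ 1) x ∂Q = ψN := by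
      have hτ1 := hτle 1 (by omega)
      have h : Integrable (fun y => ψ y * L y) (Q.bind (κ (τ 1))) := by rwa [hκQ _ hτ1]
      refine ⟨?_, ?_⟩
      · rw [funext (hftil (τ 1))]
        exact integrable_integral_kernel_of_bind hψL h
      · rw [funext (hftil (τ 1)), ← integral_bind_kernel h, hκQ _ hτ1, hψN]
    have hX1 := hX_meas 1 le_rfl (by omega) i
    have hZ : Zodd 1 i = fun ω => ftil (τ 1) (X 1 i ω) - ψN := by
      ext ω
      rw [hZodd 1 le_rfl (by omega), Nat.sub_self, hτ0, hftil_zero, hH0, mul_one]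
    have hcomp : Integrable (fun ω => ftil (τ 1) (X 1 i ω)) P := by
      have h := hint.1
      rw [← hlaw_init i] at h
      exact h.comp_measurable hX1
    rw [hZ, integral_sub hcomp (integrable_const _),
      ← integral_map hX1.aemeasurable (hftil_meas _).aestronglyMeasurable, hlaw_init, hint.2]
    simp
  · obtain ⟨s, rfl⟩ : ∃ t, s = t + 1 := ⟨s - 1, by omega⟩
    have h₁' : 1 ≤ s := by omega
    have h₂' : s ≤ r := by omega
    have hXbar_int : ∀ᵐ ω ∂P, Integrable (fun y => ψ y * L y) (κ (τ s) (Xbar s i ω)) :=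
      ae_of_ae_map (hXbar_meas s h₁' h₂' i).aemeasurable
        ((hXbar_ac s h₁' h₂' (hX_ac s h₁' (by omega)) i).ae_le (hQint (hτle s (by omega))))
    have htower : ∀ᵐ ω ∂P, Integrable (ftil (τ (s + 1))) (κ (τ s) (Xbar s i ω)) ∧
        ∫ y, ftil (τ (s + 1)) y ∂κ (τ s) (Xbar s i ω) = ftil (τ s) (Xbar s i ω) :=
      hXbar_int.mono fun ω hω => hftil_tower (hτmono s h₂').le (hτle (s + 1) h₂) hω
    have h := condExp_sub_integral_kernel_mul_eq_zero (h𝓕le (2 * s))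
      (hX_meas (s + 1) (by omega) h₂ i) (hXbarmeas s h₁' h₂' i) (κ (τ s))
      (hlaw_step s h₁' h₂' i) (hftil_meas (τ (s + 1))) (htower.mono fun ω hω => hω.1)
      (hH_meas s h₁' h₂' i)
    have hZ : Zodd (s + 1) i =ᵐ[P] fun ω => (ftil (τ (s + 1)) (X (s + 1) i ω)
        - ∫ y, ftil (τ (s + 1)) y ∂κ (τ s) (Xbar s i ω)) * H s i ω := by
      filter_upwards [htower] with ω hω
      rw [hZodd (s + 1) (by omega) h₂, Nat.add_sub_cancel, hω.2]
    rw [show 2 * (s + 1) - 2 = 2 * s by omega]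
    exact (condExp_congr_ae hZ).trans h
  · have hiid := condExp_indicator_of_iid (hVpos s h₁ (by omega)) (hVsum s h₁ (by omega))
      (hresample s h₁ h₂) i
    have h := condExp_select_sub_sum_eq_zero (h𝓕le (2 * s - 1)) (fun j => (hiid j).1)
      (fun j => (hiid j).2) (c := fun j ω => ftil (τ s) (X s j ω) * Htil s j ω)
      fun j => ((hftil_meas (τ s)).comp (hXmeas s h₁ (by omega) j)).mul
        (hHtil_meas s h₁ (by omega) j)
    have hZ : Zeven s i = fun ω => ftil (τ s) (X s (I s i ω) ω) * Htil s (I s i ω) ω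
        - ∑ j, V s j ω * (ftil (τ s) (X s j ω) * Htil s j ω) := by
      ext ω
      rw [hZeven s h₁ h₂, hH s h₁ h₂, hHtil s h₁ (by omega), hXbarI s h₁ h₂]
      simp_rw [mul_assoc]
    rw [hZ]
    exact h
  · set a : ℕ → ℝ := fun s => ∑ i, ftil (τ s) (Xbar s i ω) * H s i ω with ha
    set b : ℕ → ℝ := fun s => ∑ i, ftil (τ (s + 1)) (X (s + 1) i ω) * H s i ω with hb
    have hodd (s : ℕ) (hs : s ≤ r) : ∑ i, Zodd (s + 1) i ω = b s - a s := by
      rw [ha, hb, ← Finset.sum_sub_distrib]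
      refine Finset.sum_congr rfl fun i _ => ?_
      rw [hZodd (s + 1) (by omega) (by omega), Nat.add_sub_cancel, sub_mul]
    have heven (s : ℕ) (hs : s < r) : ∑ i, Zeven (s + 1) i ω = a (s + 1) - b s := by
      simp only [hZeven (s + 1) (by omega) (by omega), Finset.sum_sub_distrib, Finset.sum_const,
        Finset.card_univ, Fintype.card_fin, nsmul_eq_mul, ha, hb]
      rw [Finset.mul_sum]
      congr 1
      refine Finset.sum_congr rfl fun j _ => ?_
      rw [← hweights s hs.le j ω]
      ring
    have hshift (f : ℕ → ℝ) (n : ℕ) :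
        ∑ s ∈ Finset.Icc 1 n, f s = ∑ s ∈ Finset.range n, f (s + 1) := by
      rw [Finset.range_eq_Ico, Finset.sum_Ico_add' f 0 n 1]
      rfl
    have ha0 : a 0 = M * ψN := by simp [ha, hτ0, hftil_zero, hH0]
    have hbr : b r = M * ψtil ω := by
      rw [hψtil, ← mul_assoc, mul_one_div_cancel hMpos.ne', one_mul]
      refine Finset.sum_congr rfl fun i _ => ?_
      rw [hτN, hftil_N, mul_comm (ψ _)]
    rw [hshift, hshift, Finset.sum_congr rfl fun s hs =>
      hodd s (Nat.lt_succ_iff.1 (Finset.mem_range.1 hs)), Finset.sum_congr rfl fun s hs =>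
      heven s (Finset.mem_range.1 hs), Finset.sum_range_succ, Finset.sum_sub_distrib,
      Finset.sum_sub_distrib, mul_sub, ← hbr, ← ha0]
    have htel := Finset.sum_range_sub a r
    rw [Finset.sum_sub_distrib] at htel
    linarith
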